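/- Lowering relation in the second variable index x₂: for every real q with 0 < q < 1, every positive integer N, all nonzero real numbers θ, φ, all integers n₁, n₂ ≥ 0 with n₁+n₂ ≤ N, and all integers x₁ ≥ 0, x₂ ≥ 1 with x₁+x₂ ≤ N, one has (q^{1-x₁-x₂}/θ²)(1-q^{x₂}) K_{n₁,n₂}(x₁,x₂-1; θ,φ; N) = q^{1-2n₁} K_{n₁+1,n₂}(x₁,x₂; q^{1/2}θ, φ; N+1) + φ² q^{-n₁-2n₂}(1-θ^{-2}q^{n₁}) K_{n₁,n₂+1}(x₁,x₂; q^{1/2}θ, φ; N+1) - φ² q^{-N-1}(1-q^{N-n₁-n₂+1})(1-θ^{-2}q^{n₁}) K_{n₁,n₂}(x₁,x₂; q^{1/2}θ, φ; N+1). -/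

import Mathlib

open Finset

/-- The q-Pochhammer symbol `(a;q)_n = ∏_{k=0}^{n-1} (1 - a q^k)`. -/
noncomputable def qPoch (q a : ℝ) (n : ℕ) : ℝ := ∏ k ∈ Finset.range n, (1 - a * q ^ k)

/-- The quantum q-Krawtchouk polynomial `k_n(x;p,N;q)`, defined for all integers `x, N`. -/
noncomputable def qKraw (q : ℝ) (n : ℕ) (x N : ℤ) (p : ℝ) : ℝ :=
  (-1 : ℝ) ^ n * q ^ (n * (n - 1) / 2) *
    ∑ k ∈ Finset.range (n + 1),
      qPoch q (q ^ (-(n : ℤ))) k * qPoch q (q ^ (-x)) k *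
        qPoch q (q ^ ((k : ℤ) - N)) (n - k) / qPoch q q k * (p * q ^ (n + 1)) ^ k

/-- The bivariate quantum q-Krawtchouk polynomial of Gasper and Rahman,
`K_{n₁,n₂}(x₁,x₂;θ,φ;N) = k_{n₁}(x₁;θ^{-2},x₁+x₂;q) k_{n₂}(x₁+x₂-n₁;φ^{-2},N-n₁;q)`,
with the convention that it vanishes when a degree index is negative. -/
noncomputable def Kq (q : ℝ) (n₁ n₂ x₁ x₂ : ℤ) (θ φ : ℝ) (N : ℤ) : ℝ :=
  if 0 ≤ n₁ ∧ 0 ≤ n₂ then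
    qKraw q n₁.toNat x₁ (x₁ + x₂) (θ ^ 2)⁻¹ *
      qKraw q n₂.toNat (x₁ + x₂ - n₁) (N - n₁) (φ ^ 2)⁻¹
  else 0

/-- The q-trinomial coefficient `[N; x₁, x₂]_q`. -/
noncomputable def qTrinom (q : ℝ) (N x₁ x₂ : ℕ) : ℝ :=
  qPoch q q N / (qPoch q q x₁ * qPoch q q x₂ * qPoch q q (N - x₁ - x₂))

/-- The orthogonality weight `Δ^{(N)}_{x₁,x₂}(θ,φ)`. -/
noncomputable def Δw (q : ℝ) (N x₁ x₂ : ℕ) (θ φ : ℝ) : ℝ :=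
  (-1 : ℝ) ^ (N - x₁) * (θ ^ 2 * q⁻¹) ^ (x₁ + x₂) * q ^ (x₁ * (x₁ - 1) / 2) *
    qTrinom q N x₁ x₂ * qPoch q ((θ ^ 2)⁻¹ * q) x₂ * qPoch q ((φ ^ 2)⁻¹ * q) (N - x₁ - x₂) *
    φ ^ (2 * N) * q ^ (-((N : ℤ) * (N + 1) / 2))

/-- The normalization constant `H^{(N)}_{n₁,n₂}(θ,φ)`. -/
noncomputable def Hn (q : ℝ) (N n₁ n₂ : ℕ) (θ φ : ℝ) : ℝ :=
  (-1 : ℝ) ^ (n₁ + n₂) * qPoch q (q * (θ ^ 2)⁻¹) n₁ * qPoch q (q * (φ ^ 2)⁻¹) n₂ *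
    φ ^ (2 * n₁) * (qPoch q q N / qPoch q q (N - n₁ - n₂)) ^ 2 * (qTrinom q N n₁ n₂)⁻¹ *
    q ^ (3 * ((n₁ : ℤ) * (n₁ - 1)) / 2 + 3 * ((n₂ : ℤ) * (n₂ - 1)) / 2 +
          (n₁ : ℤ) * n₂ - (N : ℤ) * (n₁ + n₂) - 2 * n₁ - n₂)

/-- The dual weight `Δ̃^{(N)}_{n₁,n₂}(θ,φ)`. -/
noncomputable def Δdual (q : ℝ) (N n₁ n₂ : ℕ) (θ φ : ℝ) : ℝ :=
  (-1 : ℝ) ^ (n₁ + n₂) * q ^ (-((n₁ : ℤ) * (n₁ - 1)) - (n₂ : ℤ) * (n₂ - 1)) *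
    φ ^ (-(2 * (n₁ : ℤ))) * (qPoch q q (N - n₁ - n₂) / qPoch q q N) ^ 2 * qTrinom q N n₁ n₂ *
    q ^ ((N : ℤ) * (n₁ + n₂) + 2 * n₁ + n₂ - (n₁ : ℤ) * n₂ -
          (n₁ : ℤ) * (n₁ - 1) / 2 - (n₂ : ℤ) * (n₂ - 1) / 2) /
    (qPoch q (q * (θ ^ 2)⁻¹) n₁ * qPoch q (q * (φ ^ 2)⁻¹) n₂)

theorem qPoch_succ (q a : ℝ) (n : ℕ) : qPoch q a (n + 1) = qPoch q a n * (1 - a * q ^ n) :=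
  Finset.prod_range_succ _ _

theorem qPoch_succ' (q a : ℝ) (n : ℕ) : qPoch q a (n + 1) = (1 - a) * qPoch q (a * q) n := by
  unfold qPoch
  rw [Finset.prod_range_succ', mul_comm]
  congr 1
  · simp
  · exact Finset.prod_congr rfl fun k _ => by ring

theorem one_sub_pow_ne_zero {q : ℝ} (hq0 : 0 < q) (hq1 : q < 1) (k : ℕ) :
    1 - q * q ^ k ≠ 0 := by
  have h := pow_lt_one₀ hq0.le hq1 (Nat.succ_ne_zero k)
  rw [Nat.succ_eq_add_one, pow_succ'] at h
  linarith

theorem qPoch_self_ne_zero {q : ℝ} (hq0 : 0 < q) (hq1 : q < 1) (n : ℕ) : qPoch q q n ≠ 0 :=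
  Finset.prod_ne_zero_iff.mpr fun k _ => one_sub_pow_ne_zero hq0 hq1 k

/-- The summand of `qKraw` with `r = q ^ (-n)`, `u = q ^ (-x)`, `Q = q ^ (-N)` and
`w = p * q ^ (n + 1)`. -/
noncomputable def qKrawTerm (q : ℝ) (n : ℕ) (r u Q w : ℝ) (k : ℕ) : ℝ :=
  qPoch q r k * qPoch q u k * qPoch q (q ^ k * Q) (n - k) / qPoch q q k * w ^ k

theorem qKraw_eq_sum_qKrawTerm {q : ℝ} (hq : q ≠ 0) (n : ℕ) (x N : ℤ) (p : ℝ) :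
    qKraw q n x N p = (-1) ^ n * q ^ (n * (n - 1) / 2) * ∑ k ∈ Finset.range (n + 1),
      qKrawTerm q n (q ^ n)⁻¹ (q ^ (-x)) (q ^ (-N)) (p * q ^ (n + 1)) k := by
  unfold qKraw qKrawTerm
  simp only [sub_eq_add_neg, zpow_add₀ hq, zpow_neg, zpow_natCast]

theorem sign_mul_pow_succ (q : ℝ) (n : ℕ) :
    (-1 : ℝ) ^ (n + 1) * q ^ ((n + 1) * (n + 1 - 1) / 2) =
      -q ^ n * ((-1) ^ n * q ^ (n * (n - 1) / 2)) := by
  have h : (n + 1) * (n + 1 - 1) / 2 = n * (n - 1) / 2 + n := by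
    simpa [Nat.choose_two_right, add_comm] using Nat.choose_succ_succ' n 1
  rw [h]
  ring

theorem qKrawTerm_eq_zero {q : ℝ} (hq : q ≠ 0) (n : ℕ) (u Q w : ℝ) :
    qKrawTerm q n (q ^ n)⁻¹ u Q w (n + 1) = 0 := by
  simp [qKrawTerm, qPoch_succ, hq]

theorem sum_qKrawTerm {q : ℝ} (hq : q ≠ 0) (n : ℕ) (u Q w : ℝ) :
    ∑ k ∈ Finset.range (n + 1), qKrawTerm q n (q ^ n)⁻¹ u Q w k =
      ∑ k ∈ Finset.range (n + 1), qKrawTerm q n (q ^ n)⁻¹ u Q w (k + 1) +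
        qKrawTerm q n (q ^ n)⁻¹ u Q w 0 := by
  rw [← Finset.sum_range_succ' _ (n + 1), Finset.sum_range_succ _ (n + 1),
    qKrawTerm_eq_zero hq, add_zero]

theorem qPoch_inv_pow_succ {q : ℝ} (hq : q ≠ 0) (n k : ℕ) :
    qPoch q (q ^ (n + 1))⁻¹ (k + 1) = (1 - (q ^ (n + 1))⁻¹) * qPoch q (q ^ n)⁻¹ k := by
  rw [qPoch_succ', pow_succ, mul_inv, inv_mul_cancel_right₀ hq]

/-- Termwise form of `qKraw_raising`. -/
theorem qKrawTerm_raising {q : ℝ} (hq0 : 0 < q) (hq1 : q < 1) {n k : ℕ} (hk : k ≤ n)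
    (v Q p : ℝ) :
    -(q ^ n)⁻¹ * qKrawTerm q (n + 1) (q ^ (n + 1))⁻¹ v Q (p * q ^ (n + 2)) (k + 1)
      - (Q - (q ^ n)⁻¹) * qKrawTerm q n (q ^ n)⁻¹ v Q (p * q ^ (n + 1)) (k + 1) =
    p * (q * (1 - v)) * qKrawTerm q n (q ^ n)⁻¹ (v * q) (Q * q) (p * q ^ (n + 1)) k := by
  have hq := hq0.ne'
  have h1 := one_sub_pow_ne_zero hq0 hq1 k
  have h2 := qPoch_self_ne_zero hq0 hq1 k
  obtain ⟨m, rfl⟩ := Nat.exists_eq_add_of_le hk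
  unfold qKrawTerm
  rw [qPoch_inv_pow_succ hq, qPoch_succ' q v, qPoch_succ q q,
    qPoch_succ q (q ^ (k + m))⁻¹,
    show k + m + 1 - (k + 1) = m by omega, show k + m - k = m by omega,
    show q ^ k * (Q * q) = q ^ (k + 1) * Q by ring]
  generalize qPoch q (q ^ (k + m))⁻¹ k = R
  generalize qPoch q (v * q) k = V
  generalize qPoch q q k = P at *
  generalize hD : 1 - q * q ^ k = D at *
  rcases m with _ | m
  · generalize qPoch q (q ^ (k + 1) * Q) 0 = S
    field_simp
    rw [← hD]
    ring
  · rw [show k + (m + 1) - (k + 1) = m by omega, qPoch_succ q (q ^ (k + 1) * Q)]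
    generalize qPoch q (q ^ (k + 1) * Q) m = S
    field_simp
    rw [← hD]
    ring

/-- Raising relation for the quantum q-Krawtchouk polynomials. -/
theorem qKraw_raising {q : ℝ} (hq0 : 0 < q) (hq1 : q < 1) (n : ℕ) (z L : ℤ) (p : ℝ) :
    q ^ (-2 * (n : ℤ)) * qKraw q (n + 1) z L p
      - (q ^ (-L) - (q ^ n)⁻¹) * qKraw q n z L p =
    p * (q * (1 - q ^ (-z))) * qKraw q n (z - 1) (L - 1) p := by
  have hq := hq0.ne'
  have hz : q ^ (-(z - 1)) = q ^ (-z) * q := by rw [← zpow_add_one₀ hq]; congr 1; ring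
  have hL : q ^ (-(L - 1)) = q ^ (-L) * q := by rw [← zpow_add_one₀ hq]; congr 1; ring
  have hn : q ^ (-2 * (n : ℤ)) = (q ^ n)⁻¹ * (q ^ n)⁻¹ := by
    rw [show -2 * (n : ℤ) = -n + -n by ring, zpow_add₀ hq, zpow_neg, zpow_natCast]
  simp only [qKraw_eq_sum_qKrawTerm hq, sign_mul_pow_succ, hz, hL, hn]
  generalize q ^ (-z) = v
  generalize q ^ (-L) = Q
  have hsum := Finset.sum_congr (rfl : Finset.range (n + 1) = Finset.range (n + 1))
    fun k hk => qKrawTerm_raising hq0 hq1 (Finset.mem_range_succ_iff.mp hk) v Q p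
  rw [Finset.sum_sub_distrib, ← Finset.mul_sum, ← Finset.mul_sum, ← Finset.mul_sum] at hsum
  have h0 : -(q ^ n)⁻¹ * qKrawTerm q (n + 1) (q ^ (n + 1))⁻¹ v Q (p * q ^ (n + 2)) 0
      - (Q - (q ^ n)⁻¹) * qKrawTerm q n (q ^ n)⁻¹ v Q (p * q ^ (n + 1)) 0 = 0 := by
    simp only [qKrawTerm, Nat.sub_zero, qPoch_succ q _ n]
    simp only [qPoch, Finset.range_zero, Finset.prod_empty]
    field_simp
    ring
  rw [sum_qKrawTerm hq n v Q, Finset.sum_range_succ' _ (n + 1)]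
  have hc : (q ^ n)⁻¹ * q ^ n = 1 := inv_mul_cancel₀ (pow_ne_zero n hq)
  linear_combination ((-1) ^ n * q ^ (n * (n - 1) / 2)) * (hsum + h0) -
    (q ^ n)⁻¹ * ((-1) ^ n * q ^ (n * (n - 1) / 2)) *
      (∑ k ∈ Finset.range (n + 1),
        qKrawTerm q (n + 1) (q ^ (n + 1))⁻¹ v Q (p * q ^ (n + 2)) (k + 1) +
        qKrawTerm q (n + 1) (q ^ (n + 1))⁻¹ v Q (p * q ^ (n + 2)) 0) * hc

/-- Termwise form of `qKraw_contiguous`. -/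
theorem qKrawTerm_contiguous {q : ℝ} (hq0 : 0 < q) (hq1 : q < 1) {n k : ℕ} (hk : k ≤ n)
    (u Q t : ℝ) :
    t * (q * (Q - u)) * qKrawTerm q n (q ^ n)⁻¹ u (Q * q) (t * q ^ (n + 1)) k =
    -(q * (q ^ n)⁻¹) *
        qKrawTerm q (n + 1) (q ^ (n + 1))⁻¹ u Q (t / q * q ^ (n + 2)) (k + 1)
      + q * (q ^ n)⁻¹ * (1 - q ^ n * Q) *
        qKrawTerm q n (q ^ n)⁻¹ u Q (t / q * q ^ (n + 1)) (k + 1)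
      - t * q * (1 - q ^ n * Q) *
        qKrawTerm q n (q ^ n)⁻¹ u Q (t / q * q ^ (n + 1)) k := by
  have hq := hq0.ne'
  have h1 := one_sub_pow_ne_zero hq0 hq1 k
  have h2 := qPoch_self_ne_zero hq0 hq1 k
  obtain ⟨m, rfl⟩ := Nat.exists_eq_add_of_le hk
  have hw (j : ℕ) : t / q * q ^ (j + 1) = t * q ^ j := by
    rw [pow_succ', ← mul_assoc, div_mul_cancel₀ t hq]
  unfold qKrawTerm
  rw [hw (k + m + 1), hw (k + m), qPoch_inv_pow_succ hq, qPoch_succ q u, qPoch_succ q q,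
    qPoch_succ q (q ^ (k + m))⁻¹,
    show k + m + 1 - (k + 1) = m by omega, show k + m - k = m by omega,
    show q ^ k * (Q * q) = q ^ (k + 1) * Q by ring]
  generalize qPoch q (q ^ (k + m))⁻¹ k = R
  generalize qPoch q u k = U
  generalize qPoch q q k = P at *
  generalize hD : 1 - q * q ^ k = D at *
  rcases m with _ | m
  · rw [show qPoch q (q ^ (k + 1) * Q) 0 = qPoch q (q ^ k * Q) 0 by simp [qPoch]]
    generalize qPoch q (q ^ k * Q) 0 = S
    field_simp
    rw [← hD]
    ring
  · rw [show k + (m + 1) - (k + 1) = m by omega, qPoch_succ' q (q ^ k * Q),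
      show q ^ k * Q * q = q ^ (k + 1) * Q by ring, qPoch_succ q (q ^ (k + 1) * Q)]
    generalize qPoch q (q ^ (k + 1) * Q) m = S
    field_simp
    rw [← hD]
    ring

/-- Contiguous relation for the quantum q-Krawtchouk polynomials shifting `N` and `p`. -/
theorem qKraw_contiguous {q : ℝ} (hq0 : 0 < q) (hq1 : q < 1) (n : ℕ) (x X : ℤ) (t : ℝ) :
    t * (q * (q ^ (-X) - q ^ (-x))) * qKraw q n x (X - 1) t =
    q ^ (1 - 2 * (n : ℤ)) * qKraw q (n + 1) x X (t / q)
      + (1 - t * q ^ n) * (q * (q ^ n)⁻¹ * (1 - q ^ n * q ^ (-X))) *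
        qKraw q n x X (t / q) := by
  have hq := hq0.ne'
  have hX : q ^ (-(X - 1)) = q ^ (-X) * q := by rw [← zpow_add_one₀ hq]; congr 1; ring
  have hn : q ^ (1 - 2 * (n : ℤ)) = q * (q ^ n)⁻¹ * (q ^ n)⁻¹ := by
    rw [show 1 - 2 * (n : ℤ) = 1 + -n + -n by ring, zpow_add₀ hq, zpow_add₀ hq, zpow_neg,
      zpow_natCast, zpow_one]
  simp only [qKraw_eq_sum_qKrawTerm hq, sign_mul_pow_succ, hX, hn]
  generalize q ^ (-x) = u
  generalize q ^ (-X) = Q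
  have hsum := Finset.sum_congr (rfl : Finset.range (n + 1) = Finset.range (n + 1))
    fun k hk => qKrawTerm_contiguous hq0 hq1 (Finset.mem_range_succ_iff.mp hk) u Q t
  rw [Finset.sum_sub_distrib, Finset.sum_add_distrib, ← Finset.mul_sum, ← Finset.mul_sum,
    ← Finset.mul_sum, ← Finset.mul_sum] at hsum
  have h0 : -(q * (q ^ n)⁻¹) *
        qKrawTerm q (n + 1) (q ^ (n + 1))⁻¹ u Q (t / q * q ^ (n + 2)) 0
      + q * (q ^ n)⁻¹ * (1 - q ^ n * Q) *
        qKrawTerm q n (q ^ n)⁻¹ u Q (t / q * q ^ (n + 1)) 0 = 0 := by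
    simp only [qKrawTerm, Nat.sub_zero, qPoch_succ q _ n]
    simp only [qPoch, Finset.range_zero, Finset.prod_empty]
    field_simp
    ring
  have hs := sum_qKrawTerm hq n u Q (t / q * q ^ (n + 1))
  rw [Finset.sum_range_succ' _ (n + 1)]
  have hc : (q ^ n)⁻¹ * q ^ n = 1 := inv_mul_cancel₀ (pow_ne_zero n hq)
  linear_combination ((-1) ^ n * q ^ (n * (n - 1) / 2)) * (hsum - h0
    - q * (q ^ n)⁻¹ * (1 - q ^ n * Q) * hs
    + hc * (q * (q ^ n)⁻¹ * (∑ k ∈ Finset.range (n + 1),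
        qKrawTerm q (n + 1) (q ^ (n + 1))⁻¹ u Q (t / q * q ^ (n + 2)) (k + 1) +
        qKrawTerm q (n + 1) (q ^ (n + 1))⁻¹ u Q (t / q * q ^ (n + 2)) 0)
      + t * q * (1 - q ^ n * Q) * ∑ k ∈ Finset.range (n + 1),
        qKrawTerm q n (q ^ n)⁻¹ u Q (t / q * q ^ (n + 1)) k))

/-- Lowering relation in the second variable index `x₂`. -/
theorem lowering_x2 (q : ℝ) (hq0 : 0 < q) (hq1 : q < 1)
    (N : ℕ) (hN : 0 < N) (θ φ : ℝ) (hθ : θ ≠ 0) (hφ : φ ≠ 0)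
    (n₁ n₂ : ℕ) (hn : n₁ + n₂ ≤ N) (x₁ x₂ : ℕ) (hx₂ : 1 ≤ x₂) (hx : x₁ + x₂ ≤ N) :
    q ^ (1 - (x₁ : ℤ) - x₂) / θ ^ 2 * (1 - q ^ x₂) *
        Kq q n₁ n₂ x₁ ((x₂ : ℤ) - 1) θ φ N
    = q ^ (1 - 2 * (n₁ : ℤ)) * Kq q (n₁ + 1) n₂ x₁ x₂ (Real.sqrt q * θ) φ ((N : ℤ) + 1)
      + φ ^ 2 * q ^ (-(n₁ : ℤ) - 2 * n₂) * (1 - (θ ^ 2)⁻¹ * q ^ n₁) *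
        Kq q n₁ (n₂ + 1) x₁ x₂ (Real.sqrt q * θ) φ ((N : ℤ) + 1)
      - φ ^ 2 * q ^ (-(N : ℤ) - 1) * (1 - q ^ ((N : ℤ) - n₁ - n₂ + 1)) *
        (1 - (θ ^ 2)⁻¹ * q ^ n₁) *
        Kq q n₁ n₂ x₁ x₂ (Real.sqrt q * θ) φ ((N : ℤ) + 1) := by
  have hq := hq0.ne'
  have hsq : ((Real.sqrt q * θ) ^ 2)⁻¹ = (θ ^ 2)⁻¹ / q := by
    rw [mul_pow, Real.sq_sqrt hq0.le, mul_inv, div_eq_inv_mul]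
  have e1 : (n₁ : ℤ).toNat = n₁ := Int.toNat_natCast _
  have e2 : (n₂ : ℤ).toNat = n₂ := Int.toNat_natCast _
  have e3 : ((n₁ : ℤ) + 1).toNat = n₁ + 1 := by omega
  have e4 : ((n₂ : ℤ) + 1).toNat = n₂ + 1 := by omega
  have c1 : 0 ≤ (n₁ : ℤ) := by omega
  have c2 : 0 ≤ (n₂ : ℤ) := by omega
  have c3 : 0 ≤ (n₁ : ℤ) + 1 := by omega
  have c4 : 0 ≤ (n₂ : ℤ) + 1 := by omega
  simp only [Kq, hsq, e1, e2, e3, e4, c1, c2, c3, c4, and_self, if_true]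
  have hA := qKraw_contiguous hq0 hq1 n₁ x₁ (x₁ + x₂) (θ ^ 2)⁻¹
  have hB := qKraw_raising hq0 hq1 n₂ ((x₁ : ℤ) + x₂ - n₁) ((N : ℤ) + 1 - n₁) (φ ^ 2)⁻¹
  rw [show (x₁ : ℤ) + x₂ - n₁ - 1 = x₁ + x₂ - (n₁ + 1) by ring,
    show (N : ℤ) + 1 - n₁ - 1 = N - n₁ by ring] at hB
  rw [show (x₁ : ℤ) + (x₂ - 1) = x₁ + x₂ - 1 by ring,
    show (x₁ : ℤ) + x₂ - 1 - n₁ = x₁ + x₂ - (n₁ + 1) by ring,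
    show (N : ℤ) + 1 - (n₁ + 1) = N - n₁ by ring]
  have hX : q ^ (1 - (x₁ : ℤ) - x₂) * (1 - q ^ x₂) =
      q * (q ^ (-((x₁ : ℤ) + x₂)) - q ^ (-(x₁ : ℤ))) := by
    rw [show 1 - (x₁ : ℤ) - x₂ = 1 + -(x₁ : ℤ) + -(x₂ : ℤ) by ring, neg_add]
    simp only [zpow_add₀ hq, zpow_one, zpow_neg, zpow_natCast]
    field_simp
  have hz : q ^ (-((x₁ : ℤ) + x₂ - n₁)) = q ^ n₁ * q ^ (-((x₁ : ℤ) + x₂)) := by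
    rw [show -((x₁ : ℤ) + x₂ - n₁) = n₁ + -((x₁ : ℤ) + x₂) by ring, zpow_add₀ hq, zpow_natCast]
  have hc2 : q ^ (-(n₁ : ℤ) - 2 * n₂) = (q ^ n₁)⁻¹ * q ^ (-2 * (n₂ : ℤ)) := by
    rw [show -(n₁ : ℤ) - 2 * n₂ = -n₁ + -2 * n₂ by ring, zpow_add₀ hq, zpow_neg, zpow_natCast]
  have hc3 : q ^ (-(N : ℤ) - 1) * (1 - q ^ ((N : ℤ) - n₁ - n₂ + 1)) =
      (q ^ n₁)⁻¹ * (q ^ (-((N : ℤ) + 1 - n₁)) - (q ^ n₂)⁻¹) := by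
    rw [mul_sub, ← zpow_add₀ hq, mul_sub, ← zpow_natCast, ← zpow_natCast, ← zpow_neg, ← zpow_neg,
      ← zpow_add₀ hq, ← zpow_add₀ hq, mul_one]
    congr 2 <;> ring
  have hφ2 : φ ^ 2 * (φ ^ 2)⁻¹ = 1 := mul_inv_cancel₀ (pow_ne_zero 2 hφ)
  rw [hz] at hB
  rw [div_eq_mul_inv, hc2]
  generalize qKraw q n₂ (x₁ + x₂ - (n₁ + 1)) (N - n₁) (φ ^ 2)⁻¹ = F at *
  generalize qKraw q n₁ x₁ (x₁ + x₂) ((θ ^ 2)⁻¹ / q) = G at *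
  generalize qKraw q n₁ x₁ (x₁ + x₂ - 1) (θ ^ 2)⁻¹ = H at *
  generalize qKraw q (n₂ + 1) (x₁ + x₂ - n₁) (N + 1 - n₁) (φ ^ 2)⁻¹ = B1 at *
  generalize qKraw q n₂ (x₁ + x₂ - n₁) (N + 1 - n₁) (φ ^ 2)⁻¹ = B0 at *
  linear_combination (θ ^ 2)⁻¹ * H * F * hX + F * hA
    - φ ^ 2 * (q ^ n₁)⁻¹ * (1 - (θ ^ 2)⁻¹ * q ^ n₁) * G * hB
    + φ ^ 2 * (1 - (θ ^ 2)⁻¹ * q ^ n₁) * G * B0 * hc3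
    - (q ^ n₁)⁻¹ * (1 - (θ ^ 2)⁻¹ * q ^ n₁) * G * F *
      (q * (1 - q ^ n₁ * q ^ (-((x₁ : ℤ) + x₂)))) * hφ2
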